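/- Let k be a field, A a smooth k-algebra, and j ≥ 1. Then there is a short exact sequence of A-modules 0 → I/I² ⊗_A Ω^j_A →^a J^j/(J·J)^j →^b I/I² ⊗_A Ω^{j-1}_A → 0, where a(θ̄ ⊗ δ) is the class of θ·p₁^*(δ) for θ ∈ I, δ ∈ Ω^j_A, and b is the unique map sending the class of θ·ε to 0 (θ ∈ I, ε ∈ Ω^j_{A⊗A}) and the class of γ ∧ dθ to θ̄ ⊗ Δ^*(γ) (θ ∈ I, γ ∈ Ω^{j-1}_{A⊗A}). In particular b is well defined, a is injective, b is surjective, and ker b = im a. -/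

import Mathlib

set_option maxHeartbeats 1000000
set_option synthInstance.maxHeartbeats 400000

open TensorProduct

noncomputable section

variable (k : Type) [Field k]

/-- The element `d s` of the exterior algebra `⋀_S Ω¹_{S/k}` of Kähler differentials,
i.e. the universal derivation followed by the degree-one inclusion. -/
def dE (S : Type) [CommRing S] [Algebra k S] (s : S) :
    ExteriorAlgebra S (KaehlerDifferential k S) :=
  ExteriorAlgebra.ι S (KaehlerDifferential.D k S s)

/-- `Ω^j_{S/k}`, realized as the degree-`j` component of the exterior algebra of
`Ω¹_{S/k}`, i.e. the `j`-th power of the image of `Ω¹` in the exterior algebra. -/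
def OmegaPow (S : Type) [CommRing S] [Algebra k S] (j : ℕ) :
    Submodule S (ExteriorAlgebra S (KaehlerDifferential k S)) :=
  (LinearMap.range (ExteriorAlgebra.ι S :
    KaehlerDifferential k S →ₗ[S] ExteriorAlgebra S (KaehlerDifferential k S))) ^ j

/-- `J^j`, the degree `j` part of the differential graded ideal of `Ω^•_{S/k}` generated
by an ideal `I ⊆ S`:  `J^0 = I` (inside `Ω^0 = S`), and
`J^j = I·Ω^j + dI ∧ Ω^{j-1}` for `j ≥ 1`. -/
def Jdeg (S : Type) [CommRing S] [Algebra k S] (I : Ideal S) :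
    ℕ → Submodule S (ExteriorAlgebra S (KaehlerDifferential k S))
  | 0 => I • OmegaPow k S 0
  | j + 1 =>
      I • OmegaPow k S (j + 1) ⊔
        Submodule.span S
          {x | ∃ θ ∈ I, ∃ ε ∈ OmegaPow k S j, x = dE k S θ * ε}

/-- `(J·J)^j = Σ_{a+b=j} J^a ∧ J^b`, the degree `j` part of the square of the differential
graded ideal generated by `I`. -/
def JJdeg (S : Type) [CommRing S] [Algebra k S] (I : Ideal S) (j : ℕ) :
    Submodule S (ExteriorAlgebra S (KaehlerDifferential k S)) :=
  ⨆ p : {p : ℕ × ℕ // p.1 + p.2 = j},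
    Submodule.span S
      {x | ∃ y ∈ Jdeg k S I p.1.1, ∃ z ∈ Jdeg k S I p.1.2, x = y * z}

/-- `P` is the map `Ω^•_{S/k} → Ω^•_{T/k}` of exterior algebras of differential forms
induced by a ring homomorphism `φ : S → T` (of `k`-algebras): it is a ring homomorphism
satisfying `P(s·1) = φ(s)·1` on scalars and `P(ds) = d(φ s)` on exact one-forms.  These
two conditions determine `P` uniquely, since the exterior algebra is generated as a ring
by the scalars and the exact one-forms. -/
def IsPullback (S T : Type) [CommRing S] [CommRing T] [Algebra k S] [Algebra k T]
    (φ : S →+* T)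
    (P : ExteriorAlgebra S (KaehlerDifferential k S) →+*
      ExteriorAlgebra T (KaehlerDifferential k T)) : Prop :=
  (∀ s : S, P (algebraMap S (ExteriorAlgebra S (KaehlerDifferential k S)) s) =
    algebraMap T (ExteriorAlgebra T (KaehlerDifferential k T)) (φ s)) ∧
  (∀ s : S, P (dE k S s) = dE k T (φ s))


/-- The algebra of differential forms of `S` over `k`. -/
abbrev Forms (S : Type) [CommRing S] [Algebra k S] : Type :=
  ExteriorAlgebra S (KaehlerDifferential k S)

section General

variable {k} {S : Type} [CommRing S] [Algebra k S]

/-- An additive property of differentials may be checked on the elements `s • D t`. -/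
theorem kaehler_induction {P : KaehlerDifferential k S → Prop} (zero : P 0)
    (add : ∀ x y, P x → P y → P (x + y))
    (smul_D : ∀ s t : S, P (s • KaehlerDifferential.D k S t)) (w : KaehlerDifferential k S) :
    P w := by
  have hw : w ∈ Submodule.span S (Set.range (KaehlerDifferential.D k S)) := by
    rw [KaehlerDifferential.span_range_derivation]; trivial
  refine Submodule.closure_induction (p := fun x _ => P x) zero
    (fun x y _ _ hx hy => add x y hx hy) ?_ hw
  rintro r _ ⟨t, rfl⟩
  exact smul_D r t

/-- A multiplicative and additive property of forms may be checked on scalars and exact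
one-forms. -/
theorem forms_induction {P : Forms k S → Prop}
    (add : ∀ x y, P x → P y → P (x + y)) (mul : ∀ x y, P x → P y → P (x * y))
    (scalar : ∀ s, P (algebraMap S _ s)) (exact_form : ∀ s, P (dE k S s)) (x : Forms k S) :
    P x := by
  induction x using ExteriorAlgebra.induction with
  | algebraMap r => exact scalar r
  | ι w =>
    refine kaehler_induction (P := fun w => P (ExteriorAlgebra.ι S w)) ?_ ?_ ?_ w
    · simpa using scalar 0
    · intro x y hx hy
      rw [map_add]; exact add _ _ hx hy
    · intro s t
      rw [map_smul, Algebra.smul_def]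
      exact mul _ _ (scalar s) (exact_form t)
  | mul a b ha hb => exact mul a b ha hb
  | add a b ha hb => exact add a b ha hb

theorem forms_ringHom_ext {R : Type} [Semiring R] {F G : Forms k S →+* R}
    (scalar : ∀ s, F (algebraMap S _ s) = G (algebraMap S _ s))
    (exact_form : ∀ s, F (dE k S s) = G (dE k S s)) : F = G := by
  ext x
  refine forms_induction (P := fun x => F x = G x) ?_ ?_ scalar exact_form x
  · intro x y hx hy
    rw [map_add, map_add, hx, hy]
  · intro x y hx hy
    rw [map_mul, map_mul, hx, hy]

/-- The universal property of the exterior algebra with respect to semilinear maps into an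
algebra whose scalars are restricted along a ring homomorphism. -/
theorem exists_exteriorAlgebra_lift {M R : Type} [AddCommGroup M] [Module S M] [Ring R]
    (φ : S →+* R) (central : ∀ s r, φ s * r = r * φ s) (f : M →+ R)
    (hf : ∀ s m, f (s • m) = φ s * f m) (sq : ∀ m, f m * f m = 0) :
    ∃ F : ExteriorAlgebra S M →+* R,
      (∀ s, F (algebraMap S _ s) = φ s) ∧ ∀ m, F (ExteriorAlgebra.ι S m) = f m := by
  let algR : Algebra S R := φ.toAlgebra' central
  have hsmul : ∀ (s : S) (m : M), f (s • m) = s • f m := fun s m => by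
    rw [Algebra.smul_def]; exact hf s m
  let g : M →ₗ[S] R := { f with map_smul' := hsmul }
  refine ⟨(ExteriorAlgebra.lift S ⟨g, sq⟩).toRingHom, fun s => ?_, fun m => ?_⟩
  · exact (ExteriorAlgebra.lift S ⟨g, sq⟩).commutes s
  · exact ExteriorAlgebra.lift_ι_apply S g sq m

theorem dE_mul (s t : S) : dE k S (s * t) = s • dE k S t + t • dE k S s := by
  simp [dE]

theorem dE_mem_OmegaPow (s : S) : dE k S s ∈ OmegaPow k S 1 := by
  rw [OmegaPow, pow_one]
  exact ⟨_, rfl⟩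

theorem algebraMap_mem_OmegaPow (s : S) : algebraMap S (Forms k S) s ∈ OmegaPow k S 0 := by
  rw [OmegaPow, pow_zero]
  exact Submodule.mem_one.mpr ⟨s, rfl⟩

theorem mul_mem_OmegaPow {i j : ℕ} {x y : Forms k S} (hx : x ∈ OmegaPow k S i)
    (hy : y ∈ OmegaPow k S j) : x * y ∈ OmegaPow k S (i + j) := by
  rw [OmegaPow, pow_add]
  exact Submodule.mul_mem_mul hx hy

/-- An additive property of homogeneous forms may be checked on scalars and products with
one-forms `s • d t`. -/
theorem OmegaPow_induction {P : ℕ → Forms k S → Prop}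
    (scalar : ∀ s, P 0 (algebraMap S _ s)) (zero : ∀ i, P i 0)
    (add : ∀ i x y, P i x → P i y → P i (x + y))
    (mul : ∀ (s t : S) (i : ℕ) (x : Forms k S), x ∈ OmegaPow k S i → P i x →
      P (i + 1) ((s • dE k S t) * x))
    {i : ℕ} {x : Forms k S} (hx : x ∈ OmegaPow k S i) : P i x := by
  refine Submodule.pow_induction_on_left' (C := fun i x _ => P i x) _ scalar
    (fun x y i _ _ h₁ h₂ => add i x y h₁ h₂) ?_ hx
  rintro _ ⟨w, rfl⟩ i x hx h
  refine kaehler_induction (P := fun w => P (i + 1) (ExteriorAlgebra.ι S w * x)) ?_ ?_ ?_ w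
  · simpa using zero (i + 1)
  · intro u v hu hv
    rw [map_add, add_mul]; exact add _ _ _ hu hv
  · intro s t
    rw [map_smul]; exact mul s t i x hx h

theorem IsPullback.map_smul {T : Type} [CommRing T] [Algebra k T] {φ : S →+* T}
    {P : Forms k S →+* Forms k T} (hP : IsPullback k S T φ P) (s : S) (x : Forms k S) :
    P (s • x) = φ s • P x := by
  rw [Algebra.smul_def, map_mul, hP.1, Algebra.smul_def]

theorem IsPullback.map_mem {T : Type} [CommRing T] [Algebra k T] {φ : S →+* T}
    {P : Forms k S →+* Forms k T} (hP : IsPullback k S T φ P) {i : ℕ} {x : Forms k S}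
    (hx : x ∈ OmegaPow k S i) : P x ∈ OmegaPow k T i := by
  refine OmegaPow_induction (P := fun i x => P x ∈ OmegaPow k T i) ?_ ?_ ?_ ?_ hx
  · intro s
    rw [hP.1]; exact algebraMap_mem_OmegaPow _
  · intro i
    rw [map_zero]; exact zero_mem _
  · intro i x y hx hy
    rw [map_add]; exact add_mem hx hy
  · intro s t i x _ h
    rw [map_mul, hP.map_smul, hP.2, add_comm i 1]
    exact mul_mem_OmegaPow (Submodule.smul_mem _ _ (dE_mem_OmegaPow _)) h

theorem dE_mul_dE_swap (s t : S) : dE k S s * dE k S t = -(dE k S t * dE k S s) :=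
  eq_neg_of_add_eq_zero_left (ExteriorAlgebra.ι_add_mul_swap _ _)

theorem dE_mul_comm {i : ℕ} {x : Forms k S} (hx : x ∈ OmegaPow k S i) (t : S) :
    dE k S t * x = (-1 : S) ^ i • (x * dE k S t) := by
  refine OmegaPow_induction
    (P := fun i x => dE k S t * x = (-1 : S) ^ i • (x * dE k S t)) ?_ ?_ ?_ ?_ hx
  · intro s
    rw [pow_zero, one_smul, Algebra.commutes]
  · simp
  · intro i x y hx hy
    rw [mul_add, hx, hy, add_mul, smul_add]
  · intro s u i x _ h
    rw [← mul_assoc, mul_smul_comm, dE_mul_dE_swap, smul_neg, neg_mul, smul_mul_assoc,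
      mul_assoc, h, pow_succ]
    simp only [smul_mul_assoc, mul_assoc, smul_smul, mul_smul_comm, ← neg_smul]
    congr 1
    ring

theorem smul_mem_Jdeg {I : Ideal S} {θ : S} (hθ : θ ∈ I) {j : ℕ} {ε : Forms k S}
    (hε : ε ∈ OmegaPow k S j) : θ • ε ∈ Jdeg k S I j := by
  cases j with
  | zero => exact Submodule.smul_mem_smul hθ hε
  | succ j => exact Submodule.mem_sup_left (Submodule.smul_mem_smul hθ hε)

theorem dE_mul_mem_Jdeg {I : Ideal S} {θ : S} (hθ : θ ∈ I) {j : ℕ} {ε : Forms k S}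
    (hε : ε ∈ OmegaPow k S j) : dE k S θ * ε ∈ Jdeg k S I (j + 1) :=
  Submodule.mem_sup_right (Submodule.subset_span ⟨θ, hθ, ε, hε, rfl⟩)

theorem mul_dE_mem_Jdeg {I : Ideal S} {θ : S} (hθ : θ ∈ I) {j : ℕ} {ε : Forms k S}
    (hε : ε ∈ OmegaPow k S j) : ε * dE k S θ ∈ Jdeg k S I (j + 1) := by
  have h := Submodule.smul_mem _ ((-1 : S) ^ j) (dE_mul_mem_Jdeg hθ hε)
  rwa [dE_mul_comm hε, smul_smul, ← mul_pow, neg_one_mul, neg_neg, one_pow, one_smul] at h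

/-- An additive property of forms in the differential ideal generated by `I` may be checked
on the forms `θ • ε` and `ε * dθ` with `θ ∈ I`. -/
theorem Jdeg_induction {I : Ideal S} {P : ℕ → Forms k S → Prop}
    (zero : ∀ j, P j 0) (add : ∀ j x y, P j x → P j y → P j (x + y))
    (smul : ∀ θ ∈ I, ∀ (j : ℕ) (ε : Forms k S), ε ∈ OmegaPow k S j → P j (θ • ε))
    (mul_dE : ∀ θ ∈ I, ∀ (j : ℕ) (ε : Forms k S), ε ∈ OmegaPow k S j →
      P (j + 1) (ε * dE k S θ))
    {j : ℕ} {x : Forms k S} (hx : x ∈ Jdeg k S I j) : P j x := by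
  have h₁ : ∀ (j : ℕ) (x : Forms k S), x ∈ I • OmegaPow k S j → P j x := fun j x hx =>
    Submodule.smul_induction_on hx (fun θ hθ ε hε => smul θ hθ j ε hε) (add j)
  cases j with
  | zero => exact h₁ 0 x hx
  | succ j =>
    obtain ⟨y, hy, z, hz, rfl⟩ := Submodule.mem_sup.mp hx
    refine add _ _ _ (h₁ _ y hy) ?_
    refine Submodule.closure_induction (p := fun z _ => P (j + 1) z) (zero _)
      (fun x y _ _ hx hy => add _ x y hx hy) ?_ hz
    rintro r _ ⟨θ, hθ, ε, hε, rfl⟩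
    rw [dE_mul_comm hε, smul_smul, ← smul_mul_assoc]
    exact mul_dE θ hθ j _ (Submodule.smul_mem _ _ hε)

/-- The form of `Jdeg_induction` in a fixed positive degree. -/
theorem Jdeg_succ_induction {I : Ideal S} {i : ℕ} {P : Forms k S → Prop}
    (zero : P 0) (add : ∀ x y, P x → P y → P (x + y))
    (smul : ∀ θ ∈ I, ∀ ε ∈ OmegaPow k S (i + 1), P (θ • ε))
    (mul_dE : ∀ θ ∈ I, ∀ ε ∈ OmegaPow k S i, P (ε * dE k S θ))
    {x : Forms k S} (hx : x ∈ Jdeg k S I (i + 1)) : P x := by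
  refine Jdeg_induction (P := fun j x => j = i + 1 → P x) (fun _ _ => zero)
    (fun j x y hx hy h => add x y (hx h) (hy h)) ?_ ?_ hx rfl
  · rintro θ hθ j ε hε rfl
    exact smul θ hθ ε hε
  · rintro θ hθ j ε hε h
    obtain rfl : j = i := Nat.succ_injective h
    exact mul_dE θ hθ ε hε

theorem Jdeg_mul_mem {I : Ideal S} {i j : ℕ} {x y : Forms k S} (hx : x ∈ Jdeg k S I i)
    (hy : y ∈ OmegaPow k S j) : x * y ∈ Jdeg k S I (i + j) := by
  refine Jdeg_induction (P := fun i x => x * y ∈ Jdeg k S I (i + j)) ?_ ?_ ?_ ?_ hx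
  · intro i
    rw [zero_mul]; exact zero_mem _
  · intro i u v hu hv
    rw [add_mul]; exact add_mem hu hv
  · intro θ hθ i ε hε
    rw [smul_mul_assoc]
    exact smul_mem_Jdeg hθ (mul_mem_OmegaPow hε hy)
  · intro θ hθ i ε hε
    rw [mul_assoc, dE_mul_comm hy, mul_smul_comm, ← mul_assoc, add_right_comm]
    exact Submodule.smul_mem _ _ (mul_dE_mem_Jdeg hθ (mul_mem_OmegaPow hε hy))

theorem mul_Jdeg_mem {I : Ideal S} {i j : ℕ} {x y : Forms k S} (hx : x ∈ OmegaPow k S i)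
    (hy : y ∈ Jdeg k S I j) : x * y ∈ Jdeg k S I (i + j) := by
  refine Jdeg_induction (P := fun j y => x * y ∈ Jdeg k S I (i + j)) ?_ ?_ ?_ ?_ hy
  · intro i
    rw [mul_zero]; exact zero_mem _
  · intro i u v hu hv
    rw [mul_add]; exact add_mem hu hv
  · intro θ hθ i ε hε
    rw [mul_smul_comm]
    exact smul_mem_Jdeg hθ (mul_mem_OmegaPow hx hε)
  · intro θ hθ i ε hε
    rw [← mul_assoc, ← add_assoc]
    exact mul_dE_mem_Jdeg hθ (mul_mem_OmegaPow hx hε)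

theorem mul_mem_JJdeg {I : Ideal S} {i j l : ℕ} (h : i + j = l) {x y : Forms k S}
    (hx : x ∈ Jdeg k S I i) (hy : y ∈ Jdeg k S I j) : x * y ∈ JJdeg k S I l :=
  Submodule.mem_iSup_of_mem (p := fun p : {p : ℕ × ℕ // p.1 + p.2 = l} =>
      Submodule.span S {x | ∃ y ∈ Jdeg k S I p.1.1, ∃ z ∈ Jdeg k S I p.1.2, x = y * z})
    ⟨(i, j), h⟩ (Submodule.subset_span ⟨x, hx, y, hy, rfl⟩)

theorem smul_mem_JJdeg {I : Ideal S} {θ : S} (hθ : θ ∈ I) {j : ℕ} {x : Forms k S}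
    (hx : x ∈ Jdeg k S I j) : θ • x ∈ JJdeg k S I j := by
  rw [Algebra.smul_def]
  refine mul_mem_JJdeg (zero_add j) ?_ hx
  rw [Algebra.algebraMap_eq_smul_one]
  exact smul_mem_Jdeg hθ (by simpa using algebraMap_mem_OmegaPow (k := k) (1 : S))

/-- An additive map vanishing on products of forms in the differential ideal generated by `I`
vanishes on the square of this ideal. -/
theorem map_JJdeg_eq_zero {I : Ideal S} {G : Type} [AddCommGroup G] (F : Forms k S →+ G)
    (hF : ∀ (i j : ℕ) (x y : Forms k S), x ∈ Jdeg k S I i → y ∈ Jdeg k S I j → F (x * y) = 0)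
    {l : ℕ} {x : Forms k S} (hx : x ∈ JJdeg k S I l) : F x = 0 := by
  refine Submodule.iSup_induction (motive := fun x => F x = 0) _ hx ?_ (map_zero F) ?_
  · rintro ⟨⟨i, j⟩, _⟩ x hx
    refine Submodule.closure_induction (p := fun x _ => F x = 0) (map_zero F) ?_ ?_ hx
    · intro x y _ _ hx hy
      rw [map_add, hx, hy, add_zero]
    · rintro r _ ⟨y, hy, z, hz, rfl⟩
      rw [← smul_mul_assoc]
      exact hF i j _ _ (Submodule.smul_mem _ _ hy) hz
  · intro x y hx hy
    rw [map_add, hx, hy, add_zero]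

end General

section Diagonal

variable {k} {A : Type} [CommRing A] [Algebra k A]

/-- The `A`-linear projection `A ⊗ A → Ω¹_A`, `x ⊗ y ↦ x dy`, extending `I → I/I²`. -/
abbrev idealProj : A ⊗[k] A →ₗ[A] KaehlerDifferential k A :=
  (KaehlerDifferential.D k A).tensorProductTo

theorem idealProj_of_mem {θ : A ⊗[k] A} (hθ : θ ∈ KaehlerDifferential.ideal k A) :
    idealProj θ = KaehlerDifferential.fromIdeal k A ⟨θ, hθ⟩ :=
  KaehlerDifferential.D_tensorProductTo ⟨θ, hθ⟩

theorem idealProj_mul (s t : A ⊗[k] A) :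
    idealProj (s * t) = Algebra.TensorProduct.lmul' k (S := A) s • idealProj t +
      Algebra.TensorProduct.lmul' k (S := A) t • idealProj s :=
  Derivation.tensorProductTo_mul _ s t

theorem smul_kaehler_eq (t : A ⊗[k] A) (w : KaehlerDifferential k A) :
    t • w = Algebra.TensorProduct.lmul' k (S := A) t • w := by
  obtain ⟨⟨θ, hθ⟩, rfl⟩ := KaehlerDifferential.fromIdeal_surjective k A w
  rw [← map_smul]
  have h : t • (⟨θ, hθ⟩ : KaehlerDifferential.ideal k A) =
      ⟨t * θ, Ideal.mul_mem_left _ _ hθ⟩ := rfl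
  have hθ' : Algebra.TensorProduct.lmul' k (S := A) θ = 0 := hθ
  rw [h, ← idealProj_of_mem, ← idealProj_of_mem hθ, idealProj_mul, hθ', zero_smul, add_zero]

/-- The derivation `A ⊗ A → Ω¹_A` extending `I → I/I²`. -/
def idealDerivation : Derivation k (A ⊗[k] A) (KaehlerDifferential k A) where
  toLinearMap := idealProj.restrictScalars k
  map_one_eq_zero' := by
    have h : (1 : A ⊗[k] A) = 1 ⊗ₜ 1 := rfl
    simp [h, Derivation.tensorProductTo_tmul]
  leibniz' s t := by
    rw [smul_kaehler_eq, smul_kaehler_eq]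
    exact idealProj_mul s t

/-- The operator `(x, y) ↦ (v x, v y + m ⊗ σ x)`, with `σ` the grading involution. -/
def triangularOp (v : Forms k A) (m : KaehlerDifferential k A) :
    Module.End A (Forms k A × (KaehlerDifferential k A ⊗[A] Forms k A)) :=
  LinearMap.prod (LinearMap.mulLeft A v ∘ₗ LinearMap.fst A _ _)
    ((LinearMap.mulLeft A v).lTensor _ ∘ₗ LinearMap.snd A _ _ +
      TensorProduct.mk A _ _ m ∘ₗ CliffordAlgebra.involute.toLinearMap ∘ₗ LinearMap.fst A _ _)

theorem triangularOp_apply (v : Forms k A) (m : KaehlerDifferential k A) (x : Forms k A)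
    (y : KaehlerDifferential k A ⊗[A] Forms k A) :
    triangularOp v m (x, y) =
      (v * x, (LinearMap.mulLeft A v).lTensor _ y + m ⊗ₜ CliffordAlgebra.involute x) := rfl

theorem mulLeft_add (v w : Forms k A) :
    LinearMap.mulLeft A (v + w) = LinearMap.mulLeft A v + LinearMap.mulLeft A w :=
  LinearMap.ext fun x => add_mul v w x

theorem mulLeft_smul (a : A) (v : Forms k A) :
    LinearMap.mulLeft A (a • v) = a • LinearMap.mulLeft A v :=
  LinearMap.ext fun x => smul_mul_assoc a v x

theorem mulLeft_mul (v w : Forms k A) :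
    LinearMap.mulLeft A (v * w) = LinearMap.mulLeft A v ∘ₗ LinearMap.mulLeft A w :=
  LinearMap.ext fun x => mul_assoc v w x

theorem triangularOp_add (v w : Forms k A) (m n : KaehlerDifferential k A) :
    triangularOp (v + w) (m + n) = triangularOp v m + triangularOp w n := by
  refine LinearMap.ext ?_
  rintro ⟨x, y⟩
  rw [LinearMap.add_apply, triangularOp_apply, triangularOp_apply, triangularOp_apply,
    mulLeft_add, LinearMap.lTensor_add, TensorProduct.add_tmul, LinearMap.add_apply, add_mul,
    Prod.mk_add_mk]
  congr 1
  abel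

theorem triangularOp_smul (a : A) (v : Forms k A) (m : KaehlerDifferential k A) :
    triangularOp (a • v) (a • m) = algebraMap A _ a * triangularOp v m := by
  refine LinearMap.ext ?_
  rintro ⟨x, y⟩
  rw [Module.End.mul_apply, Module.algebraMap_end_apply, triangularOp_apply, triangularOp_apply,
    mulLeft_smul, LinearMap.lTensor_smul, smul_mul_assoc, LinearMap.smul_apply, Prod.smul_mk,
    smul_add, TensorProduct.smul_tmul']

theorem triangularOp_ι_sq (w m : KaehlerDifferential k A) :
    triangularOp (ExteriorAlgebra.ι A w) m * triangularOp (ExteriorAlgebra.ι A w) m = 0 := by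
  refine LinearMap.ext ?_
  rintro ⟨x, y⟩
  have hz : LinearMap.mulLeft A (0 : Forms k A) = 0 := LinearMap.ext fun x => zero_mul x
  rw [Module.End.mul_apply, triangularOp_apply, triangularOp_apply, map_add,
    ← LinearMap.comp_apply, ← LinearMap.lTensor_comp, ← mulLeft_mul, ← mul_assoc,
    ExteriorAlgebra.ι_sq_zero, zero_mul, hz, LinearMap.lTensor_zero, LinearMap.zero_apply,
    zero_add, LinearMap.lTensor_tmul, LinearMap.mulLeft_apply, map_mul]
  have hσ : CliffordAlgebra.involute (ExteriorAlgebra.ι A w) = -ExteriorAlgebra.ι A w :=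
    CliffordAlgebra.involute_ι w
  rw [hσ, neg_mul, TensorProduct.tmul_neg, add_neg_cancel]
  rfl

/-- A ring homomorphism from forms on `A ⊗ A` to triangular operators whose diagonal part is
the restriction to the diagonal. -/
theorem exists_triangularRep (Δs : Forms k (A ⊗[k] A) →+* Forms k A)
    (hΔs : IsPullback k (A ⊗[k] A) A
      ((Algebra.TensorProduct.lmul' k (S := A) : A ⊗[k] A →ₐ[k] A) : A ⊗[k] A →+* A) Δs) :
    ∃ Ψ : Forms k (A ⊗[k] A) →+*
        Module.End A (Forms k A × (KaehlerDifferential k A ⊗[A] Forms k A)),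
      (∀ s, Ψ (algebraMap _ _ s) =
        algebraMap A _ (Algebra.TensorProduct.lmul' k (S := A) s)) ∧
      ∀ s, Ψ (dE k _ s) =
        triangularOp (dE k A (Algebra.TensorProduct.lmul' k (S := A) s)) (idealProj s) := by
  let n := (idealDerivation (k := k) (A := A)).liftKaehlerDifferential
  let f : KaehlerDifferential k (A ⊗[k] A) →+
      Module.End A (Forms k A × (KaehlerDifferential k A ⊗[A] Forms k A)) :=
    AddMonoidHom.mk' (fun w => triangularOp (Δs (ExteriorAlgebra.ι _ w)) (n w))
      (fun u w => by rw [map_add, map_add, map_add, triangularOp_add])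
  obtain ⟨Ψ, h₁, h₂⟩ := exists_exteriorAlgebra_lift (S := A ⊗[k] A)
    (M := KaehlerDifferential k (A ⊗[k] A))
    ((algebraMap A (Module.End A (Forms k A × (KaehlerDifferential k A ⊗[A] Forms k A)))).comp
      ((Algebra.TensorProduct.lmul' k (S := A) : A ⊗[k] A →ₐ[k] A) : A ⊗[k] A →+* A))
    (fun s r => Algebra.commutes (Algebra.TensorProduct.lmul' k (S := A) s) r) f
    (fun s w => by
      change triangularOp (Δs (ExteriorAlgebra.ι _ (s • w))) (n (s • w)) = _
      rw [(ExteriorAlgebra.ι (A ⊗[k] A)).map_smul, hΔs.map_smul, n.map_smul, smul_kaehler_eq]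
      exact triangularOp_smul _ _ _)
    (fun w => by
      change triangularOp (Δs (ExteriorAlgebra.ι _ w)) (n w) *
        triangularOp (Δs (ExteriorAlgebra.ι _ w)) (n w) = 0
      have h : Δs (ExteriorAlgebra.ι _ w) ∈ OmegaPow k A 1 := by
        refine hΔs.map_mem ?_
        rw [OmegaPow, pow_one]
        exact ⟨w, rfl⟩
      rw [OmegaPow, pow_one] at h
      obtain ⟨u, hu⟩ := h
      rw [← hu]
      exact triangularOp_ι_sq u (n w))
  refine ⟨Ψ, h₁, fun s => ?_⟩
  rw [dE, h₂]
  change triangularOp (Δs (dE k _ s)) (n (KaehlerDifferential.D k _ s)) = _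
  rw [hΔs.2, Derivation.liftKaehlerDifferential_comp_D]
  rfl

theorem pullback_diagonal_Jdeg {Δs : Forms k (A ⊗[k] A) →+* Forms k A}
    (hΔs : IsPullback k (A ⊗[k] A) A
      ((Algebra.TensorProduct.lmul' k (S := A) : A ⊗[k] A →ₐ[k] A) : A ⊗[k] A →+* A) Δs)
    {j : ℕ} {x : Forms k (A ⊗[k] A)}
    (hx : x ∈ Jdeg k (A ⊗[k] A) (KaehlerDifferential.ideal k A) j) : Δs x = 0 := by
  refine Jdeg_induction (P := fun _ x => Δs x = 0) ?_ ?_ ?_ ?_ hx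
  · intro _
    exact map_zero Δs
  · intro _ x y hx hy
    rw [map_add, hx, hy, add_zero]
  · intro θ hθ _ ε _
    rw [hΔs.map_smul]
    exact (congrArg (· • Δs ε) hθ).trans (zero_smul A _)
  · intro θ hθ _ ε _
    have h0 : dE k A 0 = 0 := by simp [dE]
    rw [map_mul, hΔs.2]
    exact (congrArg (fun a => Δs ε * dE k A a) hθ).trans (by rw [h0, mul_zero])

/-- The map underlying the surjection of the exact sequence: it sends `γ ∧ dθ` to
`θ̄ ⊗ Δ^* γ`. -/
theorem exists_residue (Δs : Forms k (A ⊗[k] A) →+* Forms k A)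
    (hΔs : IsPullback k (A ⊗[k] A) A
      ((Algebra.TensorProduct.lmul' k (S := A) : A ⊗[k] A →ₐ[k] A) : A ⊗[k] A →+* A) Δs) :
    ∃ β : Forms k (A ⊗[k] A) →+ KaehlerDifferential k A ⊗[A] Forms k A,
      (∀ s x, β (s • x) = Algebra.TensorProduct.lmul' k (S := A) s • β x) ∧
      (∀ θ ∈ KaehlerDifferential.ideal k A, ∀ γ, β (γ * dE k _ θ) = idealProj θ ⊗ₜ Δs γ) ∧
      ∀ (i j : ℕ) (x y : Forms k (A ⊗[k] A)),
        x ∈ Jdeg k (A ⊗[k] A) (KaehlerDifferential.ideal k A) i →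
        y ∈ Jdeg k (A ⊗[k] A) (KaehlerDifferential.ideal k A) j → β (x * y) = 0 := by
  obtain ⟨Ψ, hs, hd⟩ := exists_triangularRep Δs hΔs
  have diag : ∀ γ : Forms k (A ⊗[k] A), (∀ x y, (Ψ γ (x, y)).1 = Δs γ * x) ∧
      ∀ y, Ψ γ (0, y) = (0, (LinearMap.mulLeft A (Δs γ)).lTensor _ y) := by
    intro γ
    refine forms_induction (P := fun γ => (∀ x y, (Ψ γ (x, y)).1 = Δs γ * x) ∧
      ∀ y, Ψ γ (0, y) = (0, (LinearMap.mulLeft A (Δs γ)).lTensor _ y)) ?_ ?_ ?_ ?_ γ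
    · rintro γ δ ⟨h₁, h₂⟩ ⟨h₃, h₄⟩
      refine ⟨fun x y => ?_, fun y => ?_⟩
      · rw [map_add, map_add, LinearMap.add_apply, Prod.fst_add, h₁, h₃, add_mul]
      · rw [map_add, map_add, LinearMap.add_apply, h₂, h₄, mulLeft_add, LinearMap.lTensor_add,
          Prod.mk_add_mk, add_zero, LinearMap.add_apply]
    · rintro γ δ ⟨h₁, h₂⟩ ⟨h₃, h₄⟩
      refine ⟨fun x y => ?_, fun y => ?_⟩
      · rw [map_mul, map_mul, Module.End.mul_apply, mul_assoc, ← h₃ x y, ← h₁]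
      · rw [map_mul, map_mul, Module.End.mul_apply, h₄, h₂, mulLeft_mul, LinearMap.lTensor_comp,
          LinearMap.comp_apply]
    · intro s
      refine ⟨fun x y => ?_, fun y => ?_⟩
      · rw [hs, hΔs.1, Module.algebraMap_end_apply, ← Algebra.smul_def]
        rfl
      · rw [hs, hΔs.1, Module.algebraMap_end_apply, Algebra.algebraMap_eq_smul_one, mulLeft_smul,
          LinearMap.mulLeft_one, LinearMap.lTensor_smul, LinearMap.lTensor_id, Prod.smul_mk,
          smul_zero]
        rfl
    · intro s
      refine ⟨fun x y => ?_, fun y => ?_⟩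
      · rw [hd, hΔs.2]
        rfl
      · rw [hd, hΔs.2, triangularOp_apply, mul_zero, map_zero, TensorProduct.tmul_zero, add_zero]
        rfl
  refine ⟨AddMonoidHom.mk' (fun x => (Ψ x (1, 0)).2) fun x y => by
    rw [map_add, LinearMap.add_apply, Prod.snd_add], fun s x => ?_, fun θ hθ γ => ?_,
    fun i j x y hx hy => ?_⟩
  · change (Ψ (s • x) (1, 0)).2 = _
    rw [Algebra.smul_def, map_mul, hs, Module.End.mul_apply, Module.algebraMap_end_apply]
    rfl
  · change (Ψ (γ * dE k _ θ) (1, 0)).2 = _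
    have hθ' : Algebra.TensorProduct.lmul' k (S := A) θ = 0 := hθ
    have h0 : dE k A 0 = 0 := by simp [dE]
    rw [map_mul, hd, Module.End.mul_apply, triangularOp_apply, hθ', h0, zero_mul, map_zero,
      zero_add, (diag γ).2, map_one, LinearMap.lTensor_tmul, LinearMap.mulLeft_apply, mul_one]
  · change (Ψ (x * y) (1, 0)).2 = 0
    have hz : LinearMap.mulLeft A (0 : Forms k A) = 0 := LinearMap.ext fun x => zero_mul x
    have h : Ψ y (1, 0) = (0, (Ψ y (1, 0)).2) := by
      refine Prod.ext ?_ rfl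
      rw [(diag y).1, pullback_diagonal_Jdeg hΔs hy, zero_mul]
    rw [map_mul, Module.End.mul_apply, h, (diag x).2, pullback_diagonal_Jdeg hΔs hx, hz,
      LinearMap.lTensor_zero]
    rfl

/-- Derivations along the two factors assemble to a derivation of `A ⊗ A`. -/
theorem exists_derivation_tensor {M : Type} [AddCommGroup M] [Module k M] [Module (A ⊗[k] A) M]
    [IsScalarTower k (A ⊗[k] A) M] (D₁ D₂ : A →ₗ[k] M)
    (h₁ : ∀ x y : A, D₁ (x * y) = (x ⊗ₜ[k] (1 : A)) • D₁ y + (y ⊗ₜ[k] (1 : A)) • D₁ x)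
    (h₂ : ∀ x y : A, D₂ (x * y) = ((1 : A) ⊗ₜ[k] x) • D₂ y + ((1 : A) ⊗ₜ[k] y) • D₂ x) :
    ∃ D : Derivation k (A ⊗[k] A) M,
      ∀ x y : A, D (x ⊗ₜ y) = ((1 : A) ⊗ₜ[k] y) • D₁ x + (x ⊗ₜ[k] (1 : A)) • D₂ y := by
  let L : A ⊗[k] A →ₗ[k] M := TensorProduct.lift (LinearMap.mk₂ k
    (fun x y => ((1 : A) ⊗ₜ[k] y) • D₁ x + (x ⊗ₜ[k] (1 : A)) • D₂ y)
    (fun x x' y => by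
      rw [map_add, smul_add, TensorProduct.add_tmul, add_smul]; abel)
    (fun c x y => by
      rw [map_smul, ← TensorProduct.smul_tmul', smul_assoc, smul_comm, smul_add])
    (fun x y y' => by
      rw [map_add, smul_add, TensorProduct.tmul_add, add_smul]; abel)
    (fun c x y => by
      rw [map_smul, TensorProduct.tmul_smul, smul_assoc, smul_add, smul_comm _ c (D₂ y)]))
  have hL : ∀ x y : A, L (x ⊗ₜ y) =
    ((1 : A) ⊗ₜ[k] y) • D₁ x + (x ⊗ₜ[k] (1 : A)) • D₂ y := fun x y => rfl
  have leib : ∀ s t, L (s * t) = s • L t + t • L s := by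
    intro s t
    induction s using TensorProduct.induction_on with
    | zero => simp
    | add s s' hs hs' => rw [add_mul, map_add, hs, hs', map_add, add_smul, smul_add]; abel
    | tmul x y =>
      induction t using TensorProduct.induction_on with
      | zero => simp
      | add t t' ht ht' => rw [mul_add, map_add, ht, ht', map_add, add_smul, smul_add]; abel
      | tmul x' y' =>
        rw [Algebra.TensorProduct.tmul_mul_tmul, hL, hL, hL, h₁, h₂]
        simp only [smul_add, smul_smul, Algebra.TensorProduct.tmul_mul_tmul, one_mul, mul_one]
        rw [mul_comm x' x, mul_comm y' y]
        abel
  refine ⟨{ toLinearMap := L, map_one_eq_zero' := ?_, leibniz' := leib }, hL⟩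
  have h := leib 1 1
  rw [mul_one, one_smul] at h
  exact left_eq_add.mp h

/-- A lift of the identity of a projective module `M` to a map `M → (A ⊗ A) ⊗_A M` which is
semilinear with respect to the right factor. -/
theorem exists_semilinear_lift (M : Type) [AddCommGroup M] [Module A M] [Module.Projective A M] :
    ∃ ψ : M →+ (A ⊗[k] A) ⊗[A] M,
      (∀ (c : A) (m : M), ψ (c • m) = ((1 : A) ⊗ₜ[k] c) • ψ m) ∧
      ∀ m, ψ m - (1 : A ⊗[k] A) ⊗ₜ[A] m ∈
        KaehlerDifferential.ideal k A • (⊤ : Submodule (A ⊗[k] A) ((A ⊗[k] A) ⊗[A] M)) := by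
  obtain ⟨s, hs⟩ := Module.projective_def'.mp (inferInstance : Module.Projective A M)
  let g : M → A →+ (A ⊗[k] A) ⊗[A] M := fun i =>
    AddMonoidHom.mk' (fun c => ((1 : A) ⊗ₜ[k] c) ⊗ₜ[A] i) fun c c' => by
      rw [TensorProduct.tmul_add, TensorProduct.add_tmul]
  let ψ : M →+ (A ⊗[k] A) ⊗[A] M := (Finsupp.liftAddHom g).comp s.toAddMonoidHom
  have hψ : ∀ m, ψ m = (s m).sum fun i c => ((1 : A) ⊗ₜ[k] c) ⊗ₜ[A] i := fun m => rfl
  refine ⟨ψ, fun c m => ?_, fun m => ?_⟩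
  · rw [hψ, hψ, map_smul, Finsupp.sum_smul_index, Finsupp.smul_sum]
    · refine Finsupp.sum_congr fun i _ => ?_
      rw [TensorProduct.smul_tmul', smul_eq_mul, Algebra.TensorProduct.tmul_mul_tmul, one_mul]
    · intro i
      rw [TensorProduct.tmul_zero, TensorProduct.zero_tmul]
  · have hm : m = (s m).sum fun i c => c • i := by
      have := LinearMap.congr_fun hs m
      rw [LinearMap.comp_apply, LinearMap.id_apply, Finsupp.linearCombination_apply] at this
      exact this.symm
    have h1 : (1 : A ⊗[k] A) ⊗ₜ[A] m = (s m).sum fun i c => (c ⊗ₜ[k] (1 : A)) ⊗ₜ[A] i := by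
      conv_lhs => rw [hm]
      rw [Finsupp.sum, Finsupp.sum, TensorProduct.tmul_sum]
      refine Finset.sum_congr rfl fun i _ => ?_
      rw [← TensorProduct.smul_tmul, Algebra.TensorProduct.one_def, TensorProduct.smul_tmul',
        smul_eq_mul, mul_one]
    rw [h1, hψ, ← Finsupp.sum_sub]
    refine Submodule.sum_mem _ fun i _ => ?_
    beta_reduce
    rw [← TensorProduct.sub_tmul, ← mul_one (_ - _ : A ⊗[k] A), ← smul_eq_mul,
      ← TensorProduct.smul_tmul']
    exact Submodule.smul_mem_smul
      (KaehlerDifferential.one_smul_sub_smul_one_mem_ideal k _) trivial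

theorem baseChange_ι_mul_swap {T M : Type} [CommRing T] [Algebra A T] [AddCommGroup M] [Module A M]
    (x y : T ⊗[A] M) :
    (ExteriorAlgebra.ι A).baseChange T x * (ExteriorAlgebra.ι A).baseChange T y +
      (ExteriorAlgebra.ι A).baseChange T y * (ExteriorAlgebra.ι A).baseChange T x = 0 := by
  induction x using TensorProduct.induction_on with
  | zero => simp
  | add x x' hx hx' =>
    rw [map_add, add_mul, mul_add, add_add_add_comm, hx, hx', add_zero]
  | tmul t m =>
    induction y using TensorProduct.induction_on with
    | zero => simp
    | add y y' hy hy' =>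
      rw [map_add, add_mul, mul_add, add_add_add_comm, hy, hy', add_zero]
    | tmul t' m' =>
      simp only [LinearMap.baseChange_tmul, Algebra.TensorProduct.tmul_mul_tmul]
      rw [mul_comm t' t, ← TensorProduct.tmul_add, ExteriorAlgebra.ι_add_mul_swap,
        TensorProduct.tmul_zero]

theorem baseChange_ι_sq {T M : Type} [CommRing T] [Algebra A T] [AddCommGroup M] [Module A M]
    (x : T ⊗[A] M) :
    (ExteriorAlgebra.ι A).baseChange T x * (ExteriorAlgebra.ι A).baseChange T x = 0 := by
  induction x using TensorProduct.induction_on with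
  | zero => simp
  | add x x' hx hx' =>
    rw [map_add, add_mul, mul_add, mul_add, hx, hx', zero_add, add_zero,
      baseChange_ι_mul_swap]
  | tmul t m =>
    rw [LinearMap.baseChange_tmul, Algebra.TensorProduct.tmul_mul_tmul,
      ExteriorAlgebra.ι_sq_zero, TensorProduct.tmul_zero]

/-- The map underlying a retraction of the injection of the exact sequence. -/
theorem exists_retraction [Algebra.FormallySmooth k A] (p1 : Forms k A →+* Forms k (A ⊗[k] A))
    (hp1 : IsPullback k A (A ⊗[k] A)
      (Algebra.TensorProduct.includeLeftRingHom : A →+* A ⊗[k] A) p1) :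
    ∃ ρ : Forms k (A ⊗[k] A) →+ KaehlerDifferential k A ⊗[A] Forms k A,
      (∀ θ δ, ρ (θ • p1 δ) = idealProj θ ⊗ₜ δ) ∧
      ∀ (i j : ℕ) (x y : Forms k (A ⊗[k] A)),
        x ∈ Jdeg k (A ⊗[k] A) (KaehlerDifferential.ideal k A) i →
        y ∈ Jdeg k (A ⊗[k] A) (KaehlerDifferential.ideal k A) j → ρ (x * y) = 0 := by
  obtain ⟨ψ, hψ, hψI⟩ := exists_semilinear_lift (k := k) (A := A) (KaehlerDifferential k A)
  have hψk : ∀ (c : k) (m : KaehlerDifferential k A), ψ (c • m) = c • ψ m := fun c m => by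
    rw [← algebraMap_smul A c m, hψ, Algebra.algebraMap_eq_smul_one, TensorProduct.tmul_smul,
      smul_assoc, ← Algebra.TensorProduct.one_def, one_smul]
  let D₁ : A →ₗ[k] (A ⊗[k] A) ⊗[A] KaehlerDifferential k A :=
    ((TensorProduct.mk A (A ⊗[k] A) _ 1).restrictScalars k) ∘ₗ
      (KaehlerDifferential.D k A).toLinearMap
  let ψk : KaehlerDifferential k A →ₗ[k] (A ⊗[k] A) ⊗[A] KaehlerDifferential k A :=
    { ψ with map_smul' := hψk }
  let D₂ : A →ₗ[k] (A ⊗[k] A) ⊗[A] KaehlerDifferential k A :=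
    ψk ∘ₗ (KaehlerDifferential.D k A).toLinearMap
  have hD₁ : ∀ x, D₁ x = (1 : A ⊗[k] A) ⊗ₜ[A] KaehlerDifferential.D k A x := fun x => rfl
  have hD₂ : ∀ x, D₂ x = ψ (KaehlerDifferential.D k A x) := fun x => rfl
  have hone : ∀ (x : A) (m : KaehlerDifferential k A),
      (1 : A ⊗[k] A) ⊗ₜ[A] (x • m) = (x ⊗ₜ[k] (1 : A)) • ((1 : A ⊗[k] A) ⊗ₜ[A] m) := by
    intro x m
    rw [← TensorProduct.smul_tmul, Algebra.TensorProduct.one_def, TensorProduct.smul_tmul',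
      TensorProduct.smul_tmul', smul_eq_mul, smul_eq_mul, Algebra.TensorProduct.tmul_mul_tmul]
    simp
  obtain ⟨D, hD⟩ := exists_derivation_tensor D₁ D₂
    (fun x y => by
      rw [hD₁, hD₁, hD₁, Derivation.leibniz, TensorProduct.tmul_add, hone, hone])
    (fun x y => by
      rw [hD₂, hD₂, hD₂, Derivation.leibniz, map_add, hψ, hψ])
  have hDleft : ∀ x : A, D (x ⊗ₜ 1) = (1 : A ⊗[k] A) ⊗ₜ[A] KaehlerDifferential.D k A x := by
    intro x
    rw [hD, hD₁, hD₂, Derivation.map_one_eq_zero, map_zero, smul_zero, add_zero,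
      ← Algebra.TensorProduct.one_def, one_smul]
  have hDI : ∀ θ ∈ KaehlerDifferential.ideal k A, D θ ∈ KaehlerDifferential.ideal k A •
      (⊤ : Submodule (A ⊗[k] A) ((A ⊗[k] A) ⊗[A] KaehlerDifferential k A)) := by
    intro θ hθ
    rw [← KaehlerDifferential.span_range_eq_ideal] at hθ
    refine Submodule.closure_induction (p := fun θ _ => D θ ∈ KaehlerDifferential.ideal k A •
      (⊤ : Submodule (A ⊗[k] A) ((A ⊗[k] A) ⊗[A] KaehlerDifferential k A))) ?_ ?_ ?_ hθ
    · rw [map_zero]; exact zero_mem _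
    · intro x y _ _ hx hy
      rw [map_add]; exact add_mem hx hy
    · rintro r _ ⟨b, rfl⟩
      rw [smul_eq_mul, Derivation.leibniz]
      refine add_mem (Submodule.smul_mem _ _ ?_) (Submodule.smul_mem_smul
        (KaehlerDifferential.one_smul_sub_smul_one_mem_ideal k b) trivial)
      rw [map_sub, hDleft, hD, hD₁, hD₂, Derivation.map_one_eq_zero, TensorProduct.tmul_zero,
        smul_zero, zero_add, ← Algebra.TensorProduct.one_def, one_smul]
      exact hψI _
  let f : KaehlerDifferential k (A ⊗[k] A) →ₗ[A ⊗[k] A] (A ⊗[k] A) ⊗[A] Forms k A :=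
    (ExteriorAlgebra.ι A).baseChange (A ⊗[k] A) ∘ₗ D.liftKaehlerDifferential
  let Φ : Forms k (A ⊗[k] A) →ₐ[A ⊗[k] A] (A ⊗[k] A) ⊗[A] Forms k A :=
    ExteriorAlgebra.lift (A ⊗[k] A) ⟨f, fun w => baseChange_ι_sq _⟩
  have hΦd : ∀ s, Φ (dE k _ s) = (ExteriorAlgebra.ι A).baseChange (A ⊗[k] A) (D s) := by
    intro s
    refine (ExteriorAlgebra.lift_ι_apply (A ⊗[k] A) f (fun w => baseChange_ι_sq _) _).trans ?_
    exact congrArg _ (D.liftKaehlerDifferential_comp_D s)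
  have hΦp : ∀ δ, Φ (p1 δ) = (1 : A ⊗[k] A) ⊗ₜ[A] δ := by
    have h : Φ.toRingHom.comp p1 =
        (Algebra.TensorProduct.includeRight : Forms k A →ₐ[A]
          (A ⊗[k] A) ⊗[A] Forms k A).toRingHom := by
      refine forms_ringHom_ext (fun s => ?_) fun s => ?_
      · change Φ (p1 (algebraMap A _ s)) = (1 : A ⊗[k] A) ⊗ₜ[A] algebraMap A (Forms k A) s
        rw [hp1.1, AlgHom.commutes, Algebra.algebraMap_eq_smul_one s, ← TensorProduct.smul_tmul,
          Algebra.TensorProduct.algebraMap_apply, Algebra.TensorProduct.one_def,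
          TensorProduct.smul_tmul', smul_eq_mul, mul_one]
        rfl
      · change Φ (p1 (dE k A s)) = (1 : A ⊗[k] A) ⊗ₜ[A] dE k A s
        rw [hp1.2, hΦd]
        change (ExteriorAlgebra.ι A).baseChange (A ⊗[k] A) (D (s ⊗ₜ 1)) = _
        rw [hDleft, LinearMap.baseChange_tmul]
        rfl
    exact fun δ => RingHom.congr_fun h δ
  have hΦJ : ∀ (i : ℕ) (x : Forms k (A ⊗[k] A)),
      x ∈ Jdeg k (A ⊗[k] A) (KaehlerDifferential.ideal k A) i →
      Φ x ∈ KaehlerDifferential.ideal k A •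
        (⊤ : Submodule (A ⊗[k] A) ((A ⊗[k] A) ⊗[A] Forms k A)) := by
    intro i x hx
    refine Jdeg_induction (P := fun _ x => Φ x ∈ KaehlerDifferential.ideal k A •
      (⊤ : Submodule (A ⊗[k] A) ((A ⊗[k] A) ⊗[A] Forms k A))) ?_ ?_ ?_ ?_ hx
    · intro _
      rw [map_zero]; exact zero_mem _
    · intro _ x y hx hy
      rw [map_add]; exact add_mem hx hy
    · intro θ hθ _ ε _
      rw [map_smul]
      exact Submodule.smul_mem_smul hθ trivial
    · intro θ hθ _ ε _
      rw [map_mul, hΦd]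
      refine Submodule.smul_induction_on (p := fun w => Φ ε *
        (ExteriorAlgebra.ι A).baseChange (A ⊗[k] A) w ∈ KaehlerDifferential.ideal k A •
        (⊤ : Submodule (A ⊗[k] A) ((A ⊗[k] A) ⊗[A] Forms k A))) (hDI θ hθ) ?_ ?_
      · intro r hr n _
        rw [map_smul, mul_smul_comm]
        exact Submodule.smul_mem_smul hr trivial
      · intro u v hu hv
        rw [map_add, mul_add]; exact add_mem hu hv
  let q : (A ⊗[k] A) ⊗[A] Forms k A →ₗ[A] KaehlerDifferential k A ⊗[A] Forms k A :=
    (idealProj (k := k) (A := A)).rTensor (Forms k A)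
  have hq : ∀ r ∈ KaehlerDifferential.ideal k A, ∀ s ∈ KaehlerDifferential.ideal k A,
      ∀ z, q ((r * s) • z) = 0 := by
    intro r hr s hs z
    have hr' : Algebra.TensorProduct.lmul' k (S := A) r = 0 := hr
    have hs' : Algebra.TensorProduct.lmul' k (S := A) s = 0 := hs
    induction z using TensorProduct.induction_on with
    | zero => rw [smul_zero, map_zero]
    | add z z' hz hz' => rw [smul_add, map_add, hz, hz', add_zero]
    | tmul t m =>
      rw [TensorProduct.smul_tmul', LinearMap.rTensor_tmul, smul_eq_mul, idealProj_mul,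
        idealProj_mul, map_mul, hr', hs']
      simp
  refine ⟨q.toAddMonoidHom.comp Φ.toRingHom.toAddMonoidHom, fun θ δ => ?_,
    fun i j x y hx hy => ?_⟩
  · change q (Φ (θ • p1 δ)) = _
    rw [map_smul, hΦp, TensorProduct.smul_tmul', smul_eq_mul, mul_one, LinearMap.rTensor_tmul]
  · change q (Φ (x * y)) = 0
    rw [map_mul]
    refine Submodule.smul_induction_on (p := fun u => q (u * Φ y) = 0) (hΦJ i x hx) ?_ ?_
    · intro r hr u _
      refine Submodule.smul_induction_on (p := fun v => q ((r • u) * v) = 0) (hΦJ j y hy) ?_ ?_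
      · intro s hs v _
        rw [smul_mul_smul_comm]
        exact hq r hr s hs _
      · intro v v' hv hv'
        rw [mul_add, map_add, hv, hv', add_zero]
    · intro u u' hu hu'
      rw [add_mul, map_add, hu, hu', add_zero]

/-- A form on `A ⊗ A` agrees with the pullback along `p₁` of its restriction to the diagonal,
up to the differential ideal of the diagonal. -/
theorem sub_pullback_diagonal_mem {p1 : Forms k A →+* Forms k (A ⊗[k] A)}
    (hp1 : IsPullback k A (A ⊗[k] A)
      (Algebra.TensorProduct.includeLeftRingHom : A →+* A ⊗[k] A) p1)
    {Δs : Forms k (A ⊗[k] A) →+* Forms k A}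
    (hΔs : IsPullback k (A ⊗[k] A) A
      ((Algebra.TensorProduct.lmul' k (S := A) : A ⊗[k] A →ₐ[k] A) : A ⊗[k] A →+* A) Δs)
    {i : ℕ} {ε : Forms k (A ⊗[k] A)} (hε : ε ∈ OmegaPow k (A ⊗[k] A) i) :
    ε - p1 (Δs ε) ∈ Jdeg k (A ⊗[k] A) (KaehlerDifferential.ideal k A) i := by
  let r : A ⊗[k] A → A ⊗[k] A := fun s =>
    (Algebra.TensorProduct.includeLeftRingHom : A →+* A ⊗[k] A)
      (((Algebra.TensorProduct.lmul' k (S := A) : A ⊗[k] A →ₐ[k] A) : A ⊗[k] A →+* A) s)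
  have hr : ∀ s, s - r s ∈ KaehlerDifferential.ideal k A := by
    intro s
    change Algebra.TensorProduct.lmul' k (S := A)
      (s - (Algebra.TensorProduct.lmul' k (S := A) s) ⊗ₜ 1) = 0
    rw [map_sub, Algebra.TensorProduct.lmul'_apply_tmul, mul_one, sub_self]
  refine OmegaPow_induction (P := fun i ε => ε - p1 (Δs ε) ∈
    Jdeg k (A ⊗[k] A) (KaehlerDifferential.ideal k A) i) ?_ ?_ ?_ ?_ hε
  · intro s
    rw [hΔs.1, hp1.1, ← map_sub, Algebra.algebraMap_eq_smul_one]
    exact smul_mem_Jdeg (hr s) (by simpa using algebraMap_mem_OmegaPow (k := k) (1 : A ⊗[k] A))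
  · intro i
    rw [map_zero, map_zero, sub_zero]; exact zero_mem _
  · intro i x y hx hy
    rw [map_add, map_add, add_sub_add_comm]; exact add_mem hx hy
  · intro s t i x hx h
    rw [map_mul, map_mul, hΔs.map_smul, hp1.map_smul, hΔs.2, hp1.2]
    change s • dE k _ t * x - r s • dE k _ (r t) * p1 (Δs x) ∈ _
    have hd : dE k (A ⊗[k] A) (t - r t) = dE k _ t - dE k _ (r t) := by simp [dE]
    have key : s • dE k _ t * x - r s • dE k _ (r t) * p1 (Δs x) =
        ((s - r s) • dE k _ t) * x + (r s • (dE k _ (t - r t) * x) +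
          (r s • dE k _ (r t)) * (x - p1 (Δs x))) := by
      rw [hd, sub_smul, sub_mul, sub_mul, mul_sub, smul_sub]
      simp only [smul_mul_assoc]
      abel
    rw [key]
    refine add_mem ?_ (add_mem (Submodule.smul_mem _ _ (dE_mul_mem_Jdeg (hr t) hx)) ?_)
    · rw [add_comm i 1]
      exact Jdeg_mul_mem (smul_mem_Jdeg (hr s) (dE_mem_OmegaPow t)) hx
    · rw [add_comm i 1]
      exact mul_Jdeg_mem (Submodule.smul_mem _ _ (dE_mem_OmegaPow _)) h

theorem diagonal_pullback {p1 : Forms k A →+* Forms k (A ⊗[k] A)}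
    (hp1 : IsPullback k A (A ⊗[k] A)
      (Algebra.TensorProduct.includeLeftRingHom : A →+* A ⊗[k] A) p1)
    {Δs : Forms k (A ⊗[k] A) →+* Forms k A}
    (hΔs : IsPullback k (A ⊗[k] A) A
      ((Algebra.TensorProduct.lmul' k (S := A) : A ⊗[k] A →ₐ[k] A) : A ⊗[k] A →+* A) Δs)
    (x : Forms k A) : Δs (p1 x) = x := by
  have h : ∀ s : A, ((Algebra.TensorProduct.lmul' k (S := A) : A ⊗[k] A →ₐ[k] A) :
      A ⊗[k] A →+* A) ((Algebra.TensorProduct.includeLeftRingHom : A →+* A ⊗[k] A) s) = s := by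
    intro s
    change Algebra.TensorProduct.lmul' k (S := A) (s ⊗ₜ 1) = s
    rw [Algebra.TensorProduct.lmul'_apply_tmul, mul_one]
  have hid : Δs.comp p1 = RingHom.id _ := by
    refine forms_ringHom_ext (fun s => ?_) fun s => ?_
    · rw [RingHom.comp_apply, hp1.1, hΔs.1, h]; rfl
    · rw [RingHom.comp_apply, hp1.2, hΔs.2, h]; rfl
  exact RingHom.congr_fun hid x

theorem exists_quotient_lift {R M G : Type} [Ring R] [AddCommGroup M] [Module R M]
    [AddCommGroup G] (p : Submodule R M) (F : M →+ G) (hF : ∀ x ∈ p, F x = 0) :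
    ∃ F' : M ⧸ p →+ G, ∀ x, F' (p.mkQ x) = F x :=
  ⟨QuotientAddGroup.lift p.toAddSubgroup F hF, fun _ => rfl⟩

theorem exists_OmegaPow_proj (j : ℕ) :
    ∃ pr : Forms k A →ₗ[A] OmegaPow k A j, ∀ x : OmegaPow k A j, pr x = x := by
  refine ⟨DirectSum.component A ℕ (fun i => ↥(⋀[A]^i (KaehlerDifferential k A))) j ∘ₗ
    (DirectSum.decomposeLinearEquiv
      (fun i : ℕ => ⋀[A]^i (KaehlerDifferential k A))).toLinearMap, fun x => ?_⟩
  change (DirectSum.decompose (fun i : ℕ => ⋀[A]^i (KaehlerDifferential k A))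
    (x : Forms k A)) j = x
  exact (congrArg (fun z => z j) (DirectSum.decompose_coe
    (fun i : ℕ => ⋀[A]^i (KaehlerDifferential k A)) x)).trans (DirectSum.of_eq_same _ _)

theorem cotangent_tensor_induction {N : Type} [AddCommGroup N] [Module A N]
    {P : KaehlerDifferential k A ⊗[A] N → Prop} (zero : P 0)
    (add : ∀ x y, P x → P y → P (x + y))
    (tmul : ∀ (θ : A ⊗[k] A) (hθ : θ ∈ KaehlerDifferential.ideal k A) (n : N),
      P (KaehlerDifferential.fromIdeal k A ⟨θ, hθ⟩ ⊗ₜ n)) (m) : P m := by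
  induction m using TensorProduct.induction_on with
  | zero => exact zero
  | add x y hx hy => exact add x y hx hy
  | tmul w n =>
    obtain ⟨⟨θ, hθ⟩, rfl⟩ := KaehlerDifferential.fromIdeal_surjective k A w
    exact tmul θ hθ n

/-- Biadditive maps on `(A ⊗ A) × N` which are balanced on `I × N` and vanish on `I² × N`
induce additive maps on `I/I² ⊗ N`. -/
theorem exists_cotangent_tensor_lift {N G : Type} [AddCommGroup N] [Module A N] [AddCommGroup G]
    (F : A ⊗[k] A →+ N →+ G)
    (sq : ∀ θ ∈ KaehlerDifferential.ideal k A, ∀ η ∈ KaehlerDifferential.ideal k A,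
      ∀ n, F (θ * η) n = 0)
    (balanced : ∀ (x : A), ∀ θ ∈ KaehlerDifferential.ideal k A, ∀ n,
      F ((x ⊗ₜ[k] (1 : A)) * θ) n = F θ (x • n)) :
    ∃ F' : KaehlerDifferential k A ⊗[A] N →+ G, ∀ (θ : A ⊗[k] A)
      (hθ : θ ∈ KaehlerDifferential.ideal k A) (n : N),
      F' (KaehlerDifferential.fromIdeal k A ⟨θ, hθ⟩ ⊗ₜ n) = F θ n := by
  let g : KaehlerDifferential.ideal k A →+ N →+ G :=
    F.comp (KaehlerDifferential.ideal k A).subtype.toAddMonoidHom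
  have hg : (KaehlerDifferential.fromIdeal k A).toAddMonoidHom.ker ≤ g.ker := by
    rintro ⟨θ, hθ⟩ h
    have h2 : θ ∈ KaehlerDifferential.ideal k A ^ 2 :=
      (Ideal.toCotangent_eq_zero _ ⟨θ, hθ⟩).mp h
    rw [pow_two] at h2
    change F θ = 0
    refine Submodule.mul_induction_on h2 ?_ ?_
    · intro θ hθ η hη
      exact AddMonoidHom.ext fun n => sq θ hθ η hη n
    · intro x y hx hy
      rw [map_add, hx, hy, add_zero]
  have hsurj := Function.rightInverse_surjInv (KaehlerDifferential.fromIdeal_surjective k A)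
  let F₁ : KaehlerDifferential k A →+ N →+ G :=
    (KaehlerDifferential.fromIdeal k A).toAddMonoidHom.liftOfRightInverse _ hsurj ⟨g, hg⟩
  have hF₁ : ∀ (θ : A ⊗[k] A) (hθ : θ ∈ KaehlerDifferential.ideal k A),
      F₁ (KaehlerDifferential.fromIdeal k A ⟨θ, hθ⟩) = F θ := fun θ hθ =>
    (KaehlerDifferential.fromIdeal k A).toAddMonoidHom.liftOfRightInverse_comp_apply _ hsurj
      ⟨g, hg⟩ ⟨θ, hθ⟩
  refine ⟨TensorProduct.liftAddHom F₁ fun x w n => ?_, fun θ hθ n => ?_⟩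
  · obtain ⟨⟨θ, hθ⟩, rfl⟩ := KaehlerDifferential.fromIdeal_surjective k A w
    have hx : x • KaehlerDifferential.fromIdeal k A ⟨θ, hθ⟩ =
        KaehlerDifferential.fromIdeal k A ⟨(x ⊗ₜ[k] (1 : A)) * θ, Ideal.mul_mem_left _ _ hθ⟩ := by
      rw [← idealProj_of_mem hθ, ← idealProj_of_mem (Ideal.mul_mem_left _ (x ⊗ₜ[k] (1 : A)) hθ),
        idealProj_mul,
        Algebra.TensorProduct.lmul'_apply_tmul, mul_one,
        show Algebra.TensorProduct.lmul' k (S := A) θ = 0 from hθ, zero_smul, add_zero]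
    rw [hx, hF₁, hF₁, balanced x θ hθ]
  · exact DFunLike.congr_fun (hF₁ θ hθ) n

theorem pullback_includeLeft_smul {p1 : Forms k A →+* Forms k (A ⊗[k] A)}
    (hp1 : IsPullback k A (A ⊗[k] A)
      (Algebra.TensorProduct.includeLeftRingHom : A →+* A ⊗[k] A) p1) (x : A) (δ : Forms k A) :
    p1 (x • δ) = (x ⊗ₜ[k] (1 : A)) • p1 δ :=
  hp1.map_smul x δ

theorem pullback_mul_dE {p1 : Forms k A →+* Forms k (A ⊗[k] A)}
    (hp1 : IsPullback k A (A ⊗[k] A)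
      (Algebra.TensorProduct.includeLeftRingHom : A →+* A ⊗[k] A) p1) (x : A) (θ : A ⊗[k] A)
    (δ : Forms k A) :
    p1 δ * dE k (A ⊗[k] A) ((x ⊗ₜ[k] (1 : A)) * θ) =
      p1 (x • δ) * dE k (A ⊗[k] A) θ + θ • p1 (δ * dE k A x) := by
  have hx : p1 (dE k A x) = dE k (A ⊗[k] A) (x ⊗ₜ[k] (1 : A)) := hp1.2 x
  rw [dE_mul, mul_add, mul_smul_comm, mul_smul_comm, pullback_includeLeft_smul hp1,
    smul_mul_assoc, map_mul, hx]

/-- The map `I/I² ⊗ Ω^j → Ω^j_{A ⊗ A}/(J·J)^j`, `θ ⊗ δ ↦ θ p₁^*(δ)`. -/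
theorem exists_cotangent_tensor_map {p1 : Forms k A →+* Forms k (A ⊗[k] A)}
    (hp1 : IsPullback k A (A ⊗[k] A)
      (Algebra.TensorProduct.includeLeftRingHom : A →+* A ⊗[k] A) p1) (j : ℕ) :
    ∃ a : KaehlerDifferential k A ⊗[A] OmegaPow k A j →+
        Forms k (A ⊗[k] A) ⧸ JJdeg k (A ⊗[k] A) (KaehlerDifferential.ideal k A) j,
      (∀ (θ : A ⊗[k] A) (hθ : θ ∈ KaehlerDifferential.ideal k A) (δ : OmegaPow k A j),
        a (KaehlerDifferential.fromIdeal k A ⟨θ, hθ⟩ ⊗ₜ δ) =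
          (JJdeg k (A ⊗[k] A) (KaehlerDifferential.ideal k A) j).mkQ (θ • p1 δ)) ∧
      ∀ (x : A) m, a (x • m) = (x ⊗ₜ[k] (1 : A)) • a m := by
  let q := (JJdeg k (A ⊗[k] A) (KaehlerDifferential.ideal k A) j).mkQ
  let F : A ⊗[k] A →+ OmegaPow k A j →+
      Forms k (A ⊗[k] A) ⧸ JJdeg k (A ⊗[k] A) (KaehlerDifferential.ideal k A) j :=
    AddMonoidHom.mk' (fun θ => AddMonoidHom.mk' (fun δ => q (θ • p1 δ)) fun δ δ' => by
          rw [Submodule.coe_add, map_add, smul_add, map_add]) fun θ θ' =>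
      AddMonoidHom.ext fun δ => by
        change q _ = q _ + q _
        rw [add_smul, map_add]
  obtain ⟨a, ha⟩ := exists_cotangent_tensor_lift F
    (fun θ hθ η hη δ => by
      change q ((θ * η) • p1 δ) = 0
      rw [Submodule.mkQ_apply, Submodule.Quotient.mk_eq_zero, mul_smul]
      exact smul_mem_JJdeg hθ (smul_mem_Jdeg hη (hp1.map_mem δ.2)))
    (fun x θ _ δ => by
      change q ((x ⊗ₜ 1 * θ) • p1 δ) = q (θ • p1 (x • (δ : Forms k A)))
      rw [pullback_includeLeft_smul hp1, smul_smul, mul_comm])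
  refine ⟨a, ha, fun x m => ?_⟩
  induction m using cotangent_tensor_induction with
  | zero => rw [smul_zero, map_zero, smul_zero]
  | add m n hm hn => rw [smul_add, map_add, hm, hn, map_add, smul_add]
  | tmul θ hθ δ =>
    rw [← TensorProduct.tmul_smul, ha, ha]
    change q (θ • p1 (x • (δ : Forms k A))) = (x ⊗ₜ[k] (1 : A)) • q (θ • p1 δ)
    rw [pullback_includeLeft_smul hp1 x δ, smul_comm, map_smul]

/-- Additive maps killing products of forms in the differential ideal descend to `Ω/(J·J)^l`,
after projection of the target to a single degree. -/
theorem exists_graded_quotient_lift (F : Forms k (A ⊗[k] A) →+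
      KaehlerDifferential k A ⊗[A] Forms k A)
    (hF : ∀ (i j : ℕ) (x y : Forms k (A ⊗[k] A)),
      x ∈ Jdeg k (A ⊗[k] A) (KaehlerDifferential.ideal k A) i →
      y ∈ Jdeg k (A ⊗[k] A) (KaehlerDifferential.ideal k A) j → F (x * y) = 0) (l i : ℕ) :
    ∃ (pr : Forms k A →ₗ[A] OmegaPow k A i)
      (F' : Forms k (A ⊗[k] A) ⧸ JJdeg k (A ⊗[k] A) (KaehlerDifferential.ideal k A) l →+
        KaehlerDifferential k A ⊗[A] OmegaPow k A i),
      (∀ x : OmegaPow k A i, pr x = x) ∧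
      ∀ x, F' ((JJdeg k (A ⊗[k] A) (KaehlerDifferential.ideal k A) l).mkQ x) =
        pr.lTensor (KaehlerDifferential k A) (F x) := by
  obtain ⟨pr, hpr⟩ := exists_OmegaPow_proj (k := k) (A := A) i
  obtain ⟨F', hF'⟩ := exists_quotient_lift
    (JJdeg k (A ⊗[k] A) (KaehlerDifferential.ideal k A) l)
    ((pr.lTensor (KaehlerDifferential k A)).toAddMonoidHom.comp F) fun x hx => by
      change pr.lTensor _ (F x) = 0
      rw [map_JJdeg_eq_zero F hF hx, map_zero]
  exact ⟨pr, F', hpr, hF'⟩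

theorem exists_cokernel {M N : Type} [AddCommGroup M] [AddCommGroup N] (a : M →+ N) :
    ∃ (G : Type) (_ : AddCommGroup G) (π : N →+ G), ∀ y, π y = 0 ↔ ∃ m, a m = y :=
  ⟨N ⧸ a.range, inferInstance, QuotientAddGroup.mk' a.range,
    fun y => QuotientAddGroup.eq_zero_iff y⟩

/-- A form in `J^{i+1}` with zero residue is, modulo `(J·J)^{i+1}`, a sum of forms
`θ p₁^*(δ)`. -/
theorem exists_preimage_of_residue_eq_zero {p1 : Forms k A →+* Forms k (A ⊗[k] A)}
    (hp1 : IsPullback k A (A ⊗[k] A)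
      (Algebra.TensorProduct.includeLeftRingHom : A →+* A ⊗[k] A) p1)
    {Δs : Forms k (A ⊗[k] A) →+* Forms k A}
    (hΔs : IsPullback k (A ⊗[k] A) A
      ((Algebra.TensorProduct.lmul' k (S := A) : A ⊗[k] A →ₐ[k] A) : A ⊗[k] A →+* A) Δs)
    {i : ℕ}
    (a : KaehlerDifferential k A ⊗[A] OmegaPow k A (i + 1) →+
      Forms k (A ⊗[k] A) ⧸ JJdeg k (A ⊗[k] A) (KaehlerDifferential.ideal k A) (i + 1))
    (ha : ∀ (θ : A ⊗[k] A) (hθ : θ ∈ KaehlerDifferential.ideal k A) (δ : OmegaPow k A (i + 1)),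
      a (KaehlerDifferential.fromIdeal k A ⟨θ, hθ⟩ ⊗ₜ δ) =
        (JJdeg k (A ⊗[k] A) (KaehlerDifferential.ideal k A) (i + 1)).mkQ (θ • p1 δ))
    (b : Forms k (A ⊗[k] A) ⧸ JJdeg k (A ⊗[k] A) (KaehlerDifferential.ideal k A) (i + 1) →+
      KaehlerDifferential k A ⊗[A] OmegaPow k A i)
    (hb_smul : ∀ θ ∈ KaehlerDifferential.ideal k A, ∀ ε,
      b ((JJdeg k (A ⊗[k] A) (KaehlerDifferential.ideal k A) (i + 1)).mkQ (θ • ε)) = 0)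
    (hb_dE : ∀ (θ : A ⊗[k] A) (hθ : θ ∈ KaehlerDifferential.ideal k A) (γ)
      (g : OmegaPow k A i), (g : Forms k A) = Δs γ →
      b ((JJdeg k (A ⊗[k] A) (KaehlerDifferential.ideal k A) (i + 1)).mkQ
        (γ * dE k (A ⊗[k] A) θ)) = KaehlerDifferential.fromIdeal k A ⟨θ, hθ⟩ ⊗ₜ g)
    {z : Forms k (A ⊗[k] A)}
    (hz : z ∈ Jdeg k (A ⊗[k] A) (KaehlerDifferential.ideal k A) (i + 1))
    (hbz : b ((JJdeg k (A ⊗[k] A) (KaehlerDifferential.ideal k A) (i + 1)).mkQ z) = 0) :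
    ∃ m, a m = (JJdeg k (A ⊗[k] A) (KaehlerDifferential.ideal k A) (i + 1)).mkQ z := by
  let q := (JJdeg k (A ⊗[k] A) (KaehlerDifferential.ideal k A) (i + 1)).mkQ
  obtain ⟨G, _, π, hπ⟩ := exists_cokernel a
  let F : A ⊗[k] A →+ OmegaPow k A i →+ G :=
    AddMonoidHom.mk' (fun θ => AddMonoidHom.mk' (fun δ =>
        π (q (p1 δ * dE k (A ⊗[k] A) θ))) fun δ δ' => by
          rw [Submodule.coe_add, map_add, add_mul, map_add, map_add]) fun θ θ' =>
      AddMonoidHom.ext fun δ => by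
        change π (q _) = π (q _) + π (q _)
        rw [← map_add, ← map_add, ← mul_add]
        simp [dE]
  have hdJ : ∀ θ ∈ KaehlerDifferential.ideal k A,
      dE k (A ⊗[k] A) θ ∈ Jdeg k (A ⊗[k] A) (KaehlerDifferential.ideal k A) 1 := by
    intro θ hθ
    have h1 : (1 : Forms k (A ⊗[k] A)) ∈ OmegaPow k (A ⊗[k] A) 0 := by
      simpa using algebraMap_mem_OmegaPow (k := k) (1 : A ⊗[k] A)
    simpa using mul_dE_mem_Jdeg hθ h1
  obtain ⟨c, hc⟩ := exists_cotangent_tensor_lift F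
    (fun θ hθ η hη δ => by
      change π (q (p1 δ * dE k (A ⊗[k] A) (θ * η))) = 0
      have h : q (p1 δ * dE k (A ⊗[k] A) (θ * η)) = 0 := by
        rw [Submodule.mkQ_apply, Submodule.Quotient.mk_eq_zero, dE_mul, mul_add, mul_smul_comm,
          mul_smul_comm]
        exact add_mem (smul_mem_JJdeg hθ (mul_dE_mem_Jdeg hη (hp1.map_mem δ.2)))
          (smul_mem_JJdeg hη (mul_dE_mem_Jdeg hθ (hp1.map_mem δ.2)))
      rw [h, map_zero])
    (fun x θ hθ δ => by
      change π (q (p1 δ * dE k (A ⊗[k] A) (x ⊗ₜ 1 * θ))) =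
        π (q (p1 (x • (δ : Forms k A)) * dE k (A ⊗[k] A) θ))
      rw [pullback_mul_dE hp1, map_add, map_add, add_eq_left]
      refine (hπ _).mpr ⟨KaehlerDifferential.fromIdeal k A ⟨θ, hθ⟩ ⊗ₜ
        ⟨δ * dE k A x, mul_mem_OmegaPow δ.2 (dE_mem_OmegaPow x)⟩, ha θ hθ _⟩)
  have key : π (q z) = c (b (q z)) := by
    refine Jdeg_succ_induction (P := fun z => π (q z) = c (b (q z)))
      ?_ ?_ ?_ ?_ hz
    · rw [map_zero, map_zero, map_zero, map_zero]
    · intro x y hx hy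
      rw [map_add, map_add, map_add, map_add, hx, hy]
    · intro θ hθ ε hε
      rw [hb_smul θ hθ, map_zero]
      refine (hπ _).mpr ⟨KaehlerDifferential.fromIdeal k A ⟨θ, hθ⟩ ⊗ₜ
        ⟨Δs ε, hΔs.map_mem hε⟩, (ha θ hθ _).trans (Eq.symm ?_)⟩
      refine (Submodule.Quotient.eq _).mpr ?_
      rw [← smul_sub]
      exact smul_mem_JJdeg hθ (sub_pullback_diagonal_mem hp1 hΔs hε)
    · intro θ hθ ε hε
      rw [hb_dE θ hθ ε ⟨Δs ε, hΔs.map_mem hε⟩ rfl, hc]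
      refine congrArg π ((Submodule.Quotient.eq _).mpr ?_)
      rw [← sub_mul]
      exact mul_mem_JJdeg rfl (sub_pullback_diagonal_mem hp1 hΔs hε) (hdJ θ hθ)
  rw [show b (q z) = 0 from hbz, map_zero] at key
  exact (hπ _).mp key

/-- The map `I/I² ⊗ Ω^j → Ω^j_{A ⊗ A}/(J·J)^j` is injective. -/
theorem cotangent_tensor_map_injective [Algebra.FormallySmooth k A]
    {p1 : Forms k A →+* Forms k (A ⊗[k] A)}
    (hp1 : IsPullback k A (A ⊗[k] A)
      (Algebra.TensorProduct.includeLeftRingHom : A →+* A ⊗[k] A) p1) (j : ℕ)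
    (a : KaehlerDifferential k A ⊗[A] OmegaPow k A j →+
      Forms k (A ⊗[k] A) ⧸ JJdeg k (A ⊗[k] A) (KaehlerDifferential.ideal k A) j)
    (ha : ∀ (θ : A ⊗[k] A) (hθ : θ ∈ KaehlerDifferential.ideal k A) (δ : OmegaPow k A j),
      a (KaehlerDifferential.fromIdeal k A ⟨θ, hθ⟩ ⊗ₜ δ) =
        (JJdeg k (A ⊗[k] A) (KaehlerDifferential.ideal k A) j).mkQ (θ • p1 δ)) :
    Function.Injective a := by
  obtain ⟨ρ, hρ, hρJ⟩ := exists_retraction p1 hp1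
  obtain ⟨pr, R, hpr, hR⟩ := exists_graded_quotient_lift ρ hρJ j j
  refine Function.LeftInverse.injective (g := R) fun m => ?_
  induction m using cotangent_tensor_induction with
  | zero => rw [map_zero, map_zero]
  | add m n hm hn => rw [map_add, map_add, hm, hn]
  | tmul θ hθ δ => rw [ha, hR, hρ, LinearMap.lTensor_tmul, hpr, idealProj_of_mem hθ]

/-- The residue `γ ∧ dθ ↦ θ ⊗ Δ^*(γ)` on `Ω^l_{A ⊗ A}/(J·J)^l`. -/
theorem exists_graded_residue {Δs : Forms k (A ⊗[k] A) →+* Forms k A}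
    (hΔs : IsPullback k (A ⊗[k] A) A
      ((Algebra.TensorProduct.lmul' k (S := A) : A ⊗[k] A →ₐ[k] A) : A ⊗[k] A →+* A) Δs)
    (l i : ℕ) :
    ∃ b : Forms k (A ⊗[k] A) ⧸ JJdeg k (A ⊗[k] A) (KaehlerDifferential.ideal k A) l →+
      KaehlerDifferential k A ⊗[A] OmegaPow k A i,
      (∀ (x : A) (y), b ((x ⊗ₜ[k] (1 : A)) • y) = x • b y) ∧
      (∀ θ ∈ KaehlerDifferential.ideal k A, ∀ ε,
        b ((JJdeg k (A ⊗[k] A) (KaehlerDifferential.ideal k A) l).mkQ (θ • ε)) = 0) ∧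
      ∀ (θ : A ⊗[k] A) (hθ : θ ∈ KaehlerDifferential.ideal k A) (γ)
        (g : OmegaPow k A i), (g : Forms k A) = Δs γ →
        b ((JJdeg k (A ⊗[k] A) (KaehlerDifferential.ideal k A) l).mkQ
          (γ * dE k (A ⊗[k] A) θ)) = KaehlerDifferential.fromIdeal k A ⟨θ, hθ⟩ ⊗ₜ g := by
  obtain ⟨β, hβ_smul, hβ_dE, hβJ⟩ := exists_residue Δs hΔs
  obtain ⟨pr, b, hpr, hb⟩ := exists_graded_quotient_lift β hβJ l i
  refine ⟨b, fun x y => ?_, fun θ hθ ε => ?_, fun θ hθ γ g hg => ?_⟩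
  · obtain ⟨z, rfl⟩ := Submodule.mkQ_surjective _ y
    rw [← map_smul, hb, hb, hβ_smul, Algebra.TensorProduct.lmul'_apply_tmul, mul_one, map_smul]
  · rw [hb, hβ_smul, show Algebra.TensorProduct.lmul' k (S := A) θ = 0 from hθ, zero_smul,
      map_zero]
  · rw [hb, hβ_dE θ hθ, LinearMap.lTensor_tmul, ← hg, hpr, idealProj_of_mem hθ]

/-- Additive maps on `J^{i+1}/(J·J)^{i+1}` are determined by their values on the classes of
`θ • ε` and `γ ∧ dθ`. -/
theorem Jdeg_quotient_hom_ext {S G : Type} [CommRing S] [Algebra k S] {I : Ideal S}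
    [AddCommGroup G] {i : ℕ} {p : Submodule S (Forms k S)}
    {f g : (Jdeg k S I (i + 1)).map p.mkQ →+ G}
    (smul : ∀ θ ∈ I, ∀ ε ∈ OmegaPow k S (i + 1),
      ∀ y : (Jdeg k S I (i + 1)).map p.mkQ, (y : Forms k S ⧸ p) = p.mkQ (θ • ε) → f y = g y)
    (mul_dE : ∀ θ ∈ I, ∀ ε ∈ OmegaPow k S i,
      ∀ y : (Jdeg k S I (i + 1)).map p.mkQ, (y : Forms k S ⧸ p) = p.mkQ (ε * dE k S θ) →
        f y = g y) : f = g := by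
  ext ⟨_, z, hz, rfl⟩
  obtain ⟨y, hy, h⟩ := Jdeg_succ_induction (P := fun z =>
    ∃ y : (Jdeg k S I (i + 1)).map p.mkQ, (y : Forms k S ⧸ p) = p.mkQ z ∧ f y = g y)
    ⟨0, by rw [map_zero]; rfl, by rw [map_zero, map_zero]⟩
    (by
      rintro x x' ⟨y, hy, h⟩ ⟨y', hy', h'⟩
      exact ⟨y + y', by rw [Submodule.coe_add, hy, hy', map_add], by rw [map_add, map_add, h, h']⟩)
    (fun θ hθ ε hε => ⟨⟨_, _, smul_mem_Jdeg hθ hε, rfl⟩, rfl, smul θ hθ ε hε _ rfl⟩)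
    (fun θ hθ ε hε => ⟨⟨_, _, mul_dE_mem_Jdeg hθ hε, rfl⟩, rfl, mul_dE θ hθ ε hε _ rfl⟩) hz
  obtain rfl : y = ⟨_, z, hz, rfl⟩ := Subtype.ext hy
  exact h

end Diagonal

/-!
STATEMENT 0.
Let `k` be a field, `A` a smooth `k`-algebra (finite presentation and formally smooth),
and `j ≥ 1`.  Then there is a short exact sequence of `A`-modules
`0 → I/I² ⊗_A Ω^j_A →^a J^j/(J·J)^j →^b I/I² ⊗_A Ω^{j-1}_A → 0`,
where `a(θ̄ ⊗ δ)` is the class of `θ·p₁^*(δ)` for `θ ∈ I`, `δ ∈ Ω^j_A`, and `b` is the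
unique map sending the class of `θ·ε` to `0` (`θ ∈ I`, `ε ∈ Ω^j_{A⊗A}`) and the class of
`γ ∧ dθ` to `θ̄ ⊗ Δ^*(γ)` (`θ ∈ I`, `γ ∈ Ω^{j-1}_{A⊗A}`).  In particular `b` is well
defined, `a` is injective, `b` is surjective, and `ker b = im a`.

Formalization notes:
* `I/I²` (with its `A`-module structure) is by definition `KaehlerDifferential k A`
  (Mathlib implements `Ω¹_{A/k}` as `I/I²`), and `θ ↦ θ̄` is
  `KaehlerDifferential.fromIdeal`.
* `J^j/(J·J)^j` is realized as the image `Mid` of `J^j` in `Ω^j_{A⊗A}/(J·J)^j` under the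
  quotient map `mkQ`; `a` is formalized as a map into the ambient quotient together with
  the statement that its image lies in `Mid`.
* `A`-linearity of `a` and `b` is expressed through the scalar action of `x ⊗ 1`, `x ∈ A`.
* `p₁^*` and `Δ^*` are the maps induced on differential forms by `a ↦ a⊗1` and by the
  multiplication map `A ⊗_k A → A`, characterized by `IsPullback`.
-/
theorem stmt0 (A : Type) [CommRing A] [Algebra k A]
    [Algebra.FormallySmooth k A] [Algebra.FinitePresentation k A]
    (j : ℕ) (hj : 1 ≤ j)
    (p1 : ExteriorAlgebra A (KaehlerDifferential k A) →+*
      ExteriorAlgebra (A ⊗[k] A) (KaehlerDifferential k (A ⊗[k] A)))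
    (hp1 : IsPullback k A (A ⊗[k] A)
      (Algebra.TensorProduct.includeLeftRingHom : A →+* A ⊗[k] A) p1)
    (Δs : ExteriorAlgebra (A ⊗[k] A) (KaehlerDifferential k (A ⊗[k] A)) →+*
      ExteriorAlgebra A (KaehlerDifferential k A))
    (hΔs : IsPullback k (A ⊗[k] A) A
      ((Algebra.TensorProduct.lmul' k (S := A) : A ⊗[k] A →ₐ[k] A) : A ⊗[k] A →+* A) Δs) :
    ∃ a : (KaehlerDifferential k A ⊗[A] ↥(OmegaPow k A j)) →+
        (ExteriorAlgebra (A ⊗[k] A) (KaehlerDifferential k (A ⊗[k] A)) ⧸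
          JJdeg k (A ⊗[k] A) (KaehlerDifferential.ideal k A) j),
    ∃ b : ↥((Jdeg k (A ⊗[k] A) (KaehlerDifferential.ideal k A) j).map
          (JJdeg k (A ⊗[k] A) (KaehlerDifferential.ideal k A) j).mkQ) →+
        (KaehlerDifferential k A ⊗[A] ↥(OmegaPow k A (j - 1))),
      -- defining property of `a`: `a(θ̄ ⊗ δ)` is the class of `θ·p₁^*(δ)`
      (∀ (θ : A ⊗[k] A) (hθ : θ ∈ KaehlerDifferential.ideal k A)
          (δ : ExteriorAlgebra A (KaehlerDifferential k A)) (hδ : δ ∈ OmegaPow k A j),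
        a ((KaehlerDifferential.fromIdeal k A ⟨θ, hθ⟩) ⊗ₜ[A]
            (⟨δ, hδ⟩ : ↥(OmegaPow k A j))) =
          (JJdeg k (A ⊗[k] A) (KaehlerDifferential.ideal k A) j).mkQ (θ • p1 δ)) ∧
      -- `a` is `A`-linear
      (∀ (x : A) (m : KaehlerDifferential k A ⊗[A] ↥(OmegaPow k A j)),
        a (x • m) = ((x ⊗ₜ[k] (1 : A)) : A ⊗[k] A) • a m) ∧
      -- `b` kills the classes of `θ·ε`, `θ ∈ I`, `ε ∈ Ω^j_{A⊗A}`
      (∀ (θ : A ⊗[k] A), θ ∈ KaehlerDifferential.ideal k A →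
        ∀ (ε : ExteriorAlgebra (A ⊗[k] A) (KaehlerDifferential k (A ⊗[k] A))),
          ε ∈ OmegaPow k (A ⊗[k] A) j →
        ∀ y : ↥((Jdeg k (A ⊗[k] A) (KaehlerDifferential.ideal k A) j).map
            (JJdeg k (A ⊗[k] A) (KaehlerDifferential.ideal k A) j).mkQ),
          (y : ExteriorAlgebra (A ⊗[k] A) (KaehlerDifferential k (A ⊗[k] A)) ⧸
              JJdeg k (A ⊗[k] A) (KaehlerDifferential.ideal k A) j) =
            (JJdeg k (A ⊗[k] A) (KaehlerDifferential.ideal k A) j).mkQ (θ • ε) →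
          b y = 0) ∧
      -- `b` sends the class of `γ ∧ dθ` to `θ̄ ⊗ Δ^*(γ)`
      (∀ (θ : A ⊗[k] A) (hθ : θ ∈ KaehlerDifferential.ideal k A)
          (γ : ExteriorAlgebra (A ⊗[k] A) (KaehlerDifferential k (A ⊗[k] A))),
          γ ∈ OmegaPow k (A ⊗[k] A) (j - 1) →
        ∀ y : ↥((Jdeg k (A ⊗[k] A) (KaehlerDifferential.ideal k A) j).map
            (JJdeg k (A ⊗[k] A) (KaehlerDifferential.ideal k A) j).mkQ),
          (y : ExteriorAlgebra (A ⊗[k] A) (KaehlerDifferential k (A ⊗[k] A)) ⧸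
              JJdeg k (A ⊗[k] A) (KaehlerDifferential.ideal k A) j) =
            (JJdeg k (A ⊗[k] A) (KaehlerDifferential.ideal k A) j).mkQ
              (γ * dE k (A ⊗[k] A) θ) →
        ∀ g : ↥(OmegaPow k A (j - 1)),
          (g : ExteriorAlgebra A (KaehlerDifferential k A)) = Δs γ →
          b y = (KaehlerDifferential.fromIdeal k A ⟨θ, hθ⟩) ⊗ₜ[A] g) ∧
      -- `b` is `A`-linear
      (∀ (x : A)
          (y : ↥((Jdeg k (A ⊗[k] A) (KaehlerDifferential.ideal k A) j).map
            (JJdeg k (A ⊗[k] A) (KaehlerDifferential.ideal k A) j).mkQ)),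
        b (((x ⊗ₜ[k] (1 : A)) : A ⊗[k] A) • y) = x • b y) ∧
      -- `b` is the unique (well-defined) additive map with the above two defining
      -- properties
      (∀ b' : ↥((Jdeg k (A ⊗[k] A) (KaehlerDifferential.ideal k A) j).map
            (JJdeg k (A ⊗[k] A) (KaehlerDifferential.ideal k A) j).mkQ) →+
          (KaehlerDifferential k A ⊗[A] ↥(OmegaPow k A (j - 1))),
        ((∀ (θ : A ⊗[k] A), θ ∈ KaehlerDifferential.ideal k A →
          ∀ (ε : ExteriorAlgebra (A ⊗[k] A) (KaehlerDifferential k (A ⊗[k] A))),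
            ε ∈ OmegaPow k (A ⊗[k] A) j →
          ∀ y : ↥((Jdeg k (A ⊗[k] A) (KaehlerDifferential.ideal k A) j).map
              (JJdeg k (A ⊗[k] A) (KaehlerDifferential.ideal k A) j).mkQ),
            (y : ExteriorAlgebra (A ⊗[k] A) (KaehlerDifferential k (A ⊗[k] A)) ⧸
              JJdeg k (A ⊗[k] A) (KaehlerDifferential.ideal k A) j) =
            (JJdeg k (A ⊗[k] A) (KaehlerDifferential.ideal k A) j).mkQ (θ • ε) →
            b' y = 0) ∧
         (∀ (θ : A ⊗[k] A) (hθ : θ ∈ KaehlerDifferential.ideal k A)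
            (γ : ExteriorAlgebra (A ⊗[k] A) (KaehlerDifferential k (A ⊗[k] A))),
            γ ∈ OmegaPow k (A ⊗[k] A) (j - 1) →
          ∀ y : ↥((Jdeg k (A ⊗[k] A) (KaehlerDifferential.ideal k A) j).map
              (JJdeg k (A ⊗[k] A) (KaehlerDifferential.ideal k A) j).mkQ),
            (y : ExteriorAlgebra (A ⊗[k] A) (KaehlerDifferential k (A ⊗[k] A)) ⧸
              JJdeg k (A ⊗[k] A) (KaehlerDifferential.ideal k A) j) =
            (JJdeg k (A ⊗[k] A) (KaehlerDifferential.ideal k A) j).mkQ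
              (γ * dE k (A ⊗[k] A) θ) →
          ∀ g : ↥(OmegaPow k A (j - 1)),
            (g : ExteriorAlgebra A (KaehlerDifferential k A)) = Δs γ →
            b' y = (KaehlerDifferential.fromIdeal k A ⟨θ, hθ⟩) ⊗ₜ[A] g)) →
        b' = b) ∧
      -- exactness: `a` injective, image of `a` inside `J^j/(J·J)^j`, `ker b = im a`,
      -- `b` surjective
      Function.Injective a ∧
      (∀ m, a m ∈ (Jdeg k (A ⊗[k] A) (KaehlerDifferential.ideal k A) j).map
        (JJdeg k (A ⊗[k] A) (KaehlerDifferential.ideal k A) j).mkQ) ∧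
      (∀ y : ↥((Jdeg k (A ⊗[k] A) (KaehlerDifferential.ideal k A) j).map
          (JJdeg k (A ⊗[k] A) (KaehlerDifferential.ideal k A) j).mkQ),
        b y = 0 ↔ ∃ m, a m =
          (y : ExteriorAlgebra (A ⊗[k] A) (KaehlerDifferential k (A ⊗[k] A)) ⧸
            JJdeg k (A ⊗[k] A) (KaehlerDifferential.ideal k A) j)) ∧
      Function.Surjective b := by
  cases j with
  | zero => exact absurd hj (Nat.not_succ_le_zero 0)
  | succ i =>
    obtain ⟨a, ha, ha_smul⟩ := exists_cotangent_tensor_map hp1 (i + 1)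
    obtain ⟨b, hb_lin, hb_smul, hb_dE⟩ := exists_graded_residue hΔs (i + 1) i
    have ha_inj := cotangent_tensor_map_injective hp1 (i + 1) a ha
    have ha_mem : ∀ m, a m ∈ (Jdeg k (A ⊗[k] A) (KaehlerDifferential.ideal k A) (i + 1)).map
        (JJdeg k (A ⊗[k] A) (KaehlerDifferential.ideal k A) (i + 1)).mkQ := by
      intro m
      induction m using cotangent_tensor_induction with
      | zero => rw [map_zero]; exact zero_mem _
      | add m n hm hn => rw [map_add]; exact add_mem hm hn
      | tmul θ hθ δ =>
        rw [ha]
        exact Submodule.mem_map_of_mem (smul_mem_Jdeg hθ (hp1.map_mem δ.2))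
    have hba : ∀ m, b (a m) = 0 := by
      intro m
      induction m using cotangent_tensor_induction with
      | zero => rw [map_zero, map_zero]
      | add m n hm hn => rw [map_add, map_add, hm, hn, add_zero]
      | tmul θ hθ δ => rw [ha, hb_smul θ hθ]
    have hb_surj : ∀ m, ∃ z ∈ Jdeg k (A ⊗[k] A) (KaehlerDifferential.ideal k A) (i + 1),
        b ((JJdeg k (A ⊗[k] A) (KaehlerDifferential.ideal k A) (i + 1)).mkQ z) = m := by
      intro m
      induction m using cotangent_tensor_induction with
      | zero => exact ⟨0, zero_mem _, by rw [map_zero, map_zero]⟩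
      | add m n hm hn =>
        obtain ⟨x, hx, rfl⟩ := hm
        obtain ⟨y, hy, rfl⟩ := hn
        exact ⟨x + y, add_mem hx hy, by rw [map_add, map_add]⟩
      | tmul θ hθ g =>
        exact ⟨_, mul_dE_mem_Jdeg hθ (hp1.map_mem g.2),
          hb_dE θ hθ (p1 g) g (diagonal_pullback hp1 hΔs g).symm⟩
    refine ⟨a, b.comp (Submodule.subtype _).toAddMonoidHom, fun θ hθ δ hδ => ha θ hθ ⟨δ, hδ⟩,
      ha_smul, ?_, ?_, fun x y => hb_lin x y, ?_, ha_inj, ha_mem, ?_, ?_⟩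
    · intro θ hθ ε _ y hy
      exact (congrArg b hy).trans (hb_smul θ hθ ε)
    · intro θ hθ γ _ y hy g hg
      exact (congrArg b hy).trans (hb_dE θ hθ γ g hg)
    · rintro b' ⟨hb'_smul, hb'_dE⟩
      refine Jdeg_quotient_hom_ext (fun θ hθ ε hε y hy => ?_) fun θ hθ ε hε y hy => ?_
      · exact (hb'_smul θ hθ ε hε y hy).trans ((congrArg b hy).trans (hb_smul θ hθ ε)).symm
      · exact (hb'_dE θ hθ ε hε y hy ⟨Δs ε, hΔs.map_mem hε⟩ rfl).trans
          ((congrArg b hy).trans (hb_dE θ hθ ε ⟨Δs ε, hΔs.map_mem hε⟩ rfl)).symm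
    · rintro ⟨_, z, hz, rfl⟩
      refine ⟨fun h => exists_preimage_of_residue_eq_zero hp1 hΔs a ha b hb_smul hb_dE hz h, ?_⟩
      rintro ⟨m, hm⟩
      exact (congrArg b hm.symm).trans (hba m)
    · intro m
      obtain ⟨z, hz, h⟩ := hb_surj m
      exact ⟨⟨_, z, hz, rfl⟩, h⟩

end
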